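/- arXiv:2211.16886 — 2 statements merged into one kernel-verified Lean document; each statement's English description precedes it below -/
import Mathlib

section
/- For every probability distribution Γ over [0,1]×{0,1}, the interval calibration error satisfies udCE(Γ) ≤ intCE(Γ) ≤ 4·√(ldCE(Γ)). -/
open MeasureTheory Set

noncomputable section

/-- The unit interval `[0,1]` as a type. -/
abbrev I01 : Type := unitInterval

/-- The real value of a Boolean label. -/
def lbl (y : Bool) : ℝ := if y then 1 else 0

/-- The calibration correlation `E_{(v,y)∼Γ}[(y − v)·w(v)]` against a weight function `w`. -/
def calErr (Γ : Measure (I01 × Bool)) (w : I01 → ℝ) : ℝ :=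
  ∫ p, (lbl p.2 - (p.1 : ℝ)) * w p.1 ∂Γ

/-- A prediction-label distribution `Γ` on `[0,1] × {0,1}` is perfectly calibrated iff
`E[(y − v)·w(v)] = 0` for every bounded measurable weight function `w`. -/
def PerfCal (Γ : Measure (I01 × Bool)) : Prop :=
  ∀ w : I01 → ℝ, Measurable w → (∃ C : ℝ, ∀ t, |w t| ≤ C) → calErr Γ w = 0

/-- `ext(Γ)`: couplings `Π` of triples `(u,v,y)` whose `(v,y)`-marginal is `Γ` and whose
`(u,y)`-marginal is perfectly calibrated. -/
def extSet (Γ : Measure (I01 × Bool)) : Set (Measure (I01 × I01 × Bool)) :=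
  {π | IsProbabilityMeasure π ∧
    π.map (fun p => (p.2.1, p.2.2)) = Γ ∧
    PerfCal (π.map (fun p => (p.1, p.2.2)))}

/-- The lower distance to calibration `ldCE(Γ)`. -/
def ldCE (Γ : Measure (I01 × Bool)) : ℝ :=
  sInf {x | ∃ π ∈ extSet Γ, x = ∫ p, |(p.1 : ℝ) - (p.2.1 : ℝ)| ∂π}

/-- The upper distance to calibration `udCE(Γ)`: distance to calibration via post-processing. -/
def udCE (Γ : Measure (I01 × Bool)) : ℝ :=
  sInf {x | ∃ κ : I01 → I01, Measurable κ ∧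
    PerfCal (Γ.map (fun p => (κ p.1, p.2))) ∧
    x = ∫ p, |(p.1 : ℝ) - (κ p.1 : ℝ)| ∂Γ}

/-- The smooth calibration error `smCE(Γ)`: supremum of `E[(y−v)w(v)]` over `1`-Lipschitz
weight functions `w : [0,1] → [−1,1]`. -/
def smCE (Γ : Measure (I01 × Bool)) : ℝ :=
  sSup {x | ∃ w : I01 → ℝ, LipschitzWith 1 w ∧ (∀ t, |w t| ≤ 1) ∧ x = calErr Γ w}

/-- The prediction-label distribution `D_f` induced by a predictor `f`. -/
def predDist {𝒳 : Type*} [MeasurableSpace 𝒳] (D : Measure (𝒳 × Bool)) (f : 𝒳 → I01) :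
    Measure (I01 × Bool) :=
  D.map (fun p => (f p.1, p.2))

/-- `cal(D)`: the set of measurable predictors that are perfectly calibrated w.r.t. `D`. -/
def calSet {𝒳 : Type*} [MeasurableSpace 𝒳] (D : Measure (𝒳 × Bool)) : Set (𝒳 → I01) :=
  {g | Measurable g ∧ PerfCal (predDist D g)}

/-- The true (ℓ₁) distance to calibration `dCE_D(f)`. -/
def dCE {𝒳 : Type*} [MeasurableSpace 𝒳] (D : Measure (𝒳 × Bool)) (f : 𝒳 → I01) : ℝ :=
  sInf {x | ∃ g ∈ calSet D, x = ∫ p, |(f p.1 : ℝ) - (g p.1 : ℝ)| ∂D}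

/-- A finite partition of `[0,1]` into (order-convex) intervals. -/
structure IntervalPartition where
  m : ℕ
  piece : Fin m → Set ℝ
  ordConn : ∀ j, (piece j).OrdConnected
  disj : ∀ i j, i ≠ j → Disjoint (piece i) (piece j)
  cover : (⋃ j, piece j) = Set.Icc (0 : ℝ) 1

/-- `binnedECE(Γ, 𝓘) = Σ_j |E[(v − y)·1(v ∈ I_j)]|`. -/
def binnedECE (Γ : Measure (I01 × Bool)) (P : IntervalPartition) : ℝ :=
  ∑ j : Fin P.m,
    |∫ p, Set.indicator (P.piece j) (fun _ => ((p.1 : ℝ) - lbl p.2)) (p.1 : ℝ) ∂Γ|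

/-- The average interval width `w_Γ(𝓘) = Σ_j E[1(v ∈ I_j)]·w(I_j)`. -/
def avgWidth (Γ : Measure (I01 × Bool)) (P : IntervalPartition) : ℝ :=
  ∑ j : Fin P.m,
    (∫ p, Set.indicator (P.piece j) (fun _ => (1 : ℝ)) (p.1 : ℝ) ∂Γ) * Metric.diam (P.piece j)

/-- The interval calibration error `intCE(Γ)`. -/
def intCE (Γ : Measure (I01 × Bool)) : ℝ :=
  sInf {x | ∃ P : IntervalPartition, x = binnedECE Γ P + avgWidth Γ P}

/-- The random interval calibration error `RintCE(Γ, ε)`, with `r` uniform on `[0, ε)` and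
intervals `I^ε_{r,j} = [r + jε, r + (j+1)ε)`. -/
def RintCE (Γ : Measure (I01 × Bool)) (ε : ℝ) : ℝ :=
  (1 / ε) * ∫ r in Set.Ico (0 : ℝ) ε,
    ∑' j : ℤ, |∫ p, Set.indicator (Set.Ico (r + (j : ℝ) * ε) (r + ((j : ℝ) + 1) * ε))
      (fun _ => (lbl p.2 - (p.1 : ℝ))) (p.1 : ℝ) ∂Γ|

/-- The surrogate interval calibration error `SintCE(Γ)`. -/
def SintCE (Γ : Measure (I01 × Bool)) : ℝ :=
  ⨅ k : ℕ, (RintCE Γ ((1 / 2) ^ k) + (1 / 2) ^ k)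

/-- The squared Laplace-kernel calibration error:
`K_Lap(Γ) = E[(y−v)(y′−v′)·exp(−|v−v′|)]` over two independent samples from `Γ`. -/
def KLap (Γ : Measure (I01 × Bool)) : ℝ :=
  ∫ q, (lbl q.1.2 - (q.1.1 : ℝ)) * (lbl q.2.2 - (q.2.1 : ℝ)) *
    Real.exp (-|(q.1.1 : ℝ) - (q.2.1 : ℝ)|) ∂(Γ.prod Γ)

/-- The squared Gaussian-kernel calibration error:
`K_Gauss(Γ) = E[(y−v)(y′−v′)·exp(−(v−v′)²)]` over two independent samples from `Γ`. -/
def KGauss (Γ : Measure (I01 × Bool)) : ℝ :=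
  ∫ q, (lbl q.1.2 - (q.1.1 : ℝ)) * (lbl q.2.2 - (q.2.1 : ℝ)) *
    Real.exp (-(((q.1.1 : ℝ) - (q.2.1 : ℝ)) ^ 2)) ∂(Γ.prod Γ)

theorem hp_int {α : Type*} [MeasurableSpace α] (μ : Measure α) [IsFiniteMeasure μ] {f : α → ℝ}
    (hf : Measurable f) (C : ℝ) (h : ∀ x, |f x| ≤ C) : Integrable f μ :=
  Integrable.of_bound hf.aestronglyMeasurable C (Filter.Eventually.of_forall h)

theorem hp_lbl_meas : Measurable lbl := Measurable.of_discrete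

theorem hp_lbl_nonneg (y : Bool) : 0 ≤ lbl y := by unfold lbl; split <;> norm_num

theorem hp_lbl_le (y : Bool) : lbl y ≤ 1 := by unfold lbl; split <;> norm_num

theorem hp_exists_idx (P : IntervalPartition) :
    ∃ idx : I01 → Fin P.m, Measurable idx ∧ ∀ (v : I01) j, (v : ℝ) ∈ P.piece j ↔ idx v = j := by
  have h : ∀ v : I01, ∃ j, (v : ℝ) ∈ P.piece j := by
    intro v
    have : (v : ℝ) ∈ ⋃ j, P.piece j := by rw [P.cover]; exact v.2
    simpa using this
  choose idx hidx using h
  have key : ∀ (v : I01) j, (v : ℝ) ∈ P.piece j ↔ idx v = j := by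
    intro v j
    constructor
    · intro hv
      by_contra hne
      exact Set.disjoint_left.1 (P.disj _ _ hne) (hidx v) hv
    · rintro rfl; exact hidx v
  refine ⟨idx, ?_, key⟩
  refine measurable_to_countable' fun j => ?_
  have : idx ⁻¹' {j} = (fun v : I01 => (v : ℝ)) ⁻¹' (P.piece j) := by
    ext v; simp [key]
  rw [this]
  exact measurable_subtype_coe (P.ordConn j).measurableSet

theorem hp_diam (P : IntervalPartition) (j : Fin P.m) (x y : ℝ) (hx : x ∈ P.piece j)
    (hy : y ∈ P.piece j) : |x - y| ≤ Metric.diam (P.piece j) := by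
  have hb : Bornology.IsBounded (P.piece j) := by
    refine (Metric.isBounded_Icc (0:ℝ) 1).subset ?_
    rw [← P.cover]; exact Set.subset_iUnion P.piece j
  exact Metric.dist_le_diam_of_mem hb hx hy

theorem hp_nonneg (Γ : Measure (I01 × Bool)) (P : IntervalPartition) :
    0 ≤ binnedECE Γ P + avgWidth Γ P := by
  refine add_nonneg (Finset.sum_nonneg fun j _ => abs_nonneg _) (Finset.sum_nonneg fun j _ => ?_)
  refine mul_nonneg (integral_nonneg fun p => ?_) Metric.diam_nonneg
  exact Set.indicator_nonneg (fun _ _ => zero_le_one) _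

theorem hp_ud (Γ : Measure (I01 × Bool)) [IsProbabilityMeasure Γ] (P : IntervalPartition) :
    udCE Γ ≤ binnedECE Γ P + avgWidth Γ P := by
  classical
  obtain ⟨idx, hm, hidx⟩ := hp_exists_idx P
  let e : Fin P.m → I01 × Bool → ℝ := fun j p => if idx p.1 = j then 1 else 0
  have hem : ∀ j, Measurable (e j) := fun j =>
    (Measurable.of_discrete (f := fun i : Fin P.m => if i = j then (1:ℝ) else 0)).comp
      (hm.comp measurable_fst)
  have he0 : ∀ j p, 0 ≤ e j p := by intro j p; simp only [e]; split <;> norm_num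
  have he1 : ∀ j p, e j p ≤ 1 := by intro j p; simp only [e]; split <;> norm_num
  have hlm : Measurable fun p : I01 × Bool => lbl p.2 := hp_lbl_meas.comp measurable_snd
  have hvm : Measurable fun p : I01 × Bool => (p.1 : ℝ) := measurable_subtype_coe.comp measurable_fst
  have hq : ∀ j, (∫ p, Set.indicator (P.piece j) (fun _ => (1 : ℝ)) (p.1 : ℝ) ∂Γ) = ∫ p, e j p ∂Γ := by
    intro j; congr 1; ext p; simp [Set.indicator, hidx, e]
  have hb : ∀ j, (∫ p, Set.indicator (P.piece j) (fun _ => ((p.1 : ℝ) - lbl p.2)) (p.1 : ℝ) ∂Γ)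
      = ∫ p, e j p * ((p.1 : ℝ) - lbl p.2) ∂Γ := by
    intro j; congr 1; ext p; simp [Set.indicator, hidx, e]
  -- integrability
  have ig : ∀ j (f : I01 × Bool → ℝ) (C : ℝ), Measurable f → (∀ p, |f p| ≤ C) →
      Integrable (fun p => e j p * f p) Γ := by
    intro j f C hf hC
    refine hp_int Γ ((hem j).mul hf) C fun p => ?_
    rw [abs_mul, abs_of_nonneg (he0 j p)]
    calc e j p * |f p| ≤ 1 * |f p| := by gcongr; exact he1 j p
      _ ≤ C := by simpa using hC p
  have ige : ∀ j, Integrable (e j) Γ := fun j =>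
    hp_int Γ (hem j) 1 fun p => abs_le.2 ⟨by linarith [he0 j p], he1 j p⟩
  have hlb : ∀ p : I01 × Bool, |lbl p.2| ≤ 1 := fun p =>
    abs_le.2 ⟨by linarith [hp_lbl_nonneg p.2], hp_lbl_le p.2⟩
  have hvb : ∀ p : I01 × Bool, |(p.1 : ℝ)| ≤ 1 := fun p =>
    abs_le.2 ⟨by linarith [p.1.2.1], p.1.2.2⟩
  have igl : ∀ j, Integrable (fun p => e j p * lbl p.2) Γ := fun j => ig j _ 1 hlm hlb
  have igv : ∀ j, Integrable (fun p => e j p * (p.1 : ℝ)) Γ := fun j => ig j _ 1 hvm hvb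
  let q : Fin P.m → ℝ := fun j => ∫ p, e j p ∂Γ
  let s : Fin P.m → ℝ := fun j => ∫ p, e j p * lbl p.2 ∂Γ
  let t : Fin P.m → ℝ := fun j => ∫ p, e j p * (p.1 : ℝ) ∂Γ
  have hq0 : ∀ j, 0 ≤ q j := fun j => integral_nonneg (he0 j)
  have hs0 : ∀ j, 0 ≤ s j := fun j => integral_nonneg fun p =>
    mul_nonneg (he0 j p) (hp_lbl_nonneg _)
  have hsq : ∀ j, s j ≤ q j := fun j => integral_mono (igl j) (ige j) fun p => by
    have := mul_le_mul_of_nonneg_left (hp_lbl_le p.2) (he0 j p)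
    simpa using this
  let c : Fin P.m → I01 := fun j => ⟨s j / q j, div_nonneg (hs0 j) (hq0 j),
    div_le_one_of_le₀ (hsq j) (hq0 j)⟩
  have hcq : ∀ j, (c j : ℝ) * q j = s j := by
    intro j
    by_cases h : q j = 0
    · have : s j = 0 := le_antisymm (h ▸ hsq j) (hs0 j)
      rw [h, this, mul_zero]
    · exact div_mul_cancel₀ _ h
  have hbj : ∀ j, ∫ p, e j p * ((p.1 : ℝ) - lbl p.2) ∂Γ = t j - s j := by
    intro j
    simp only [mul_sub]
    exact integral_sub (igv j) (igl j)
  have hsum : ∀ (F : Fin P.m → I01 × Bool → ℝ) p, F (idx p.1) p = ∑ j, e j p * F j p := by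
    intro F p
    simp [e]
  have hcm : Measurable c := Measurable.of_discrete
  have hκm : Measurable fun v => c (idx v) := hcm.comp hm
  have hbd : BddBelow {x | ∃ κ : I01 → I01, Measurable κ ∧
      PerfCal (Γ.map (fun p => (κ p.1, p.2))) ∧
      x = ∫ p, |(p.1 : ℝ) - (κ p.1 : ℝ)| ∂Γ} := by
    refine ⟨0, ?_⟩
    rintro x ⟨κ, -, -, rfl⟩
    exact integral_nonneg fun p => abs_nonneg _
  refine (csInf_le hbd ⟨fun v => c (idx v), hκm, ?_, rfl⟩).trans ?_
  · rintro w hw ⟨C, hC⟩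
    unfold calErr
    have hmap : Measurable fun p : I01 × Bool => (c (idx p.1), p.2) :=
      (hκm.comp measurable_fst).prodMk measurable_snd
    have hmm : Measurable fun p : I01 × Bool => (lbl p.2 - (p.1:ℝ)) * w p.1 :=
      (hlm.sub hvm).mul (hw.comp measurable_fst)
    rw [integral_map hmap.aemeasurable hmm.aestronglyMeasurable]
    have : ∀ p : I01 × Bool, (lbl p.2 - (c (idx p.1) : ℝ)) * w (c (idx p.1)) =
        ∑ j, (w (c j) * (e j p * lbl p.2) - w (c j) * (c j : ℝ) * e j p) := by
      intro p
      rw [hsum (fun j p => (lbl p.2 - (c j : ℝ)) * w (c j)) p]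
      refine Finset.sum_congr rfl fun j _ => by ring
    simp only [this]
    have hij : ∀ j, Integrable
        (fun p => w (c j) * (e j p * lbl p.2) - w (c j) * (c j : ℝ) * e j p) Γ := fun j =>
      ((igl j).const_mul _).sub ((ige j).const_mul _)
    rw [integral_finsetSum _ fun j _ => hij j]
    refine Finset.sum_eq_zero fun j _ => ?_
    rw [integral_sub ((igl j).const_mul _) ((ige j).const_mul _), integral_const_mul,
      integral_const_mul]
    change w (c j) * s j - w (c j) * (c j : ℝ) * q j = 0
    rw [← hcq j]; ring
  · have igd : ∀ j, Integrable (fun p : I01 × Bool => e j p * |(p.1 : ℝ) - (c j : ℝ)|) Γ := by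
      intro j
      refine ig j _ 1 (hvm.sub_const _).abs fun p => ?_
      rw [abs_abs, abs_le]
      constructor <;> linarith [p.1.2.1, p.1.2.2, (c j).2.1, (c j).2.2]
    have : ∀ p : I01 × Bool, |(p.1 : ℝ) - (c (idx p.1) : ℝ)| =
        ∑ j, e j p * |(p.1 : ℝ) - (c j : ℝ)| := fun p =>
      hsum (fun j p => |(p.1 : ℝ) - (c j : ℝ)|) p
    simp only [this]
    rw [integral_finsetSum _ fun j _ => igd j]
    unfold binnedECE avgWidth
    rw [← Finset.sum_add_distrib]
    refine Finset.sum_le_sum fun j _ => ?_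
    rw [hq, hb, hbj]
    change _ ≤ |t j - s j| + q j * _
    set d := Metric.diam (P.piece j) with hd
    have hd0 : 0 ≤ d := Metric.diam_nonneg
    rcases (hq0 j).eq_or_lt with h0 | hpos
    · have h1 : ∫ p, e j p * |(p.1 : ℝ) - (c j : ℝ)| ∂Γ ≤ q j := by
        refine integral_mono (igd j) (ige j) fun p => ?_
        have : |(p.1 : ℝ) - (c j : ℝ)| ≤ 1 := by
          rw [abs_le]
          constructor <;> linarith [p.1.2.1, p.1.2.2, (c j).2.1, (c j).2.2]
        simpa using mul_le_mul_of_nonneg_left this (he0 j p)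
      rw [← h0] at h1 ⊢
      have := abs_nonneg (t j - s j)
      linarith
    · have hpt : ∀ p : I01 × Bool, e j p * |(p.1 : ℝ) - (c j : ℝ)| ≤
          e j p * (d + |t j - s j| / q j) := by
        intro p
        by_cases hp : idx p.1 = j
        · refine mul_le_mul_of_nonneg_left ?_ (he0 j p)
          have hA : |(p.1 : ℝ) * q j - t j| ≤ d * q j := by
            have h2 : (p.1 : ℝ) * q j - t j = ∫ p', (p.1 : ℝ) * e j p' - e j p' * (p'.1 : ℝ) ∂Γ := by
              rw [integral_sub ((ige j).const_mul _) (igv j), integral_const_mul]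
            rw [h2]
            refine (abs_integral_le_integral_abs).trans ?_
            have h3 : d * q j = ∫ p', d * e j p' ∂Γ := by rw [integral_const_mul]
            rw [h3]
            refine integral_mono (((ige j).const_mul _).sub (igv j)).abs ((ige j).const_mul _)
              fun p' => ?_
            by_cases hp' : idx p'.1 = j
            · simpa [e, hp'] using hp_diam P j _ _ ((hidx p.1 j).2 hp) ((hidx p'.1 j).2 hp')
            · simp [e, hp']
          have hB : ((p.1 : ℝ) - (c j : ℝ)) * q j = ((p.1 : ℝ) * q j - t j) + (t j - s j) := by
            rw [← hcq j]; ring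
          have hC : |(p.1 : ℝ) - (c j : ℝ)| * q j ≤ d * q j + |t j - s j| := by
            rw [← abs_of_pos hpos, ← abs_mul, abs_of_pos hpos, hB]
            exact (abs_add_le _ _).trans (by linarith)
          have hD : (d + |t j - s j| / q j) * q j = d * q j + |t j - s j| := by
            field_simp
          exact le_of_mul_le_mul_right (hC.trans_eq hD.symm) hpos
        · simp [e, hp]
      have h1 := integral_mono (igd j) ((ige j).mul_const _) hpt
      refine h1.trans_eq ?_
      rw [integral_mul_const]
      change q j * _ = _
      field_simp
      ring

theorem hp_binned (Γ : Measure (I01 × Bool)) (π : Measure (I01 × I01 × Bool))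
    (hπ : π ∈ extSet Γ) (P : IntervalPartition) (D : I01 → I01 → ℝ)
    (hDi : Integrable (fun p : I01 × I01 × Bool => D p.1 p.2.1) π)
    (hD0 : ∀ u v, 0 ≤ D u v)
    (hD : ∀ u v : I01, (∃ j, (u : ℝ) ∈ P.piece j ∧ (v : ℝ) ∈ P.piece j) ∨ 1 ≤ D u v) :
    binnedECE Γ P ≤ ∫ p, |(p.1 : ℝ) - (p.2.1 : ℝ)| ∂π + 2 * ∫ p, D p.1 p.2.1 ∂π := by
  classical
  obtain ⟨hprob, hmarg, hcal⟩ := hπ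
  obtain ⟨idx, hm, hidx⟩ := hp_exists_idx P
  let e : Fin P.m → I01 → ℝ := fun j p => if idx p = j then 1 else 0
  have hem : ∀ j, Measurable (e j) := fun j =>
    (Measurable.of_discrete (f := fun i : Fin P.m => if i = j then (1:ℝ) else 0)).comp hm
  have he0 : ∀ j p, 0 ≤ e j p := by intro j p; simp only [e]; split <;> norm_num
  have he1 : ∀ j p, e j p ≤ 1 := by intro j p; simp only [e]; split <;> norm_num
  have heb : ∀ j p, |e j p| ≤ 1 := fun j p => abs_le.2 ⟨by linarith [he0 j p], he1 j p⟩
  have hesum : ∀ p, ∑ j, e j p = 1 := by intro p; simp [e]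
  have hl : Measurable fun p : I01 × I01 × Bool => lbl p.2.2 :=
    hp_lbl_meas.comp (measurable_snd.comp measurable_snd)
  have hu : Measurable fun p : I01 × I01 × Bool => (p.1 : ℝ) :=
    measurable_subtype_coe.comp measurable_fst
  have hv : Measurable fun p : I01 × I01 × Bool => (p.2.1 : ℝ) :=
    measurable_subtype_coe.comp (measurable_fst.comp measurable_snd)
  have heu : ∀ j, Measurable fun p : I01 × I01 × Bool => e j p.1 := fun j =>
    (hem j).comp measurable_fst
  have hev : ∀ j, Measurable fun p : I01 × I01 × Bool => e j p.2.1 := fun j =>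
    (hem j).comp (measurable_fst.comp measurable_snd)
  have huvb : ∀ u v : I01, |(u:ℝ) - v| ≤ 1 := fun u v => by
    rw [abs_le]; constructor <;> linarith [u.2.1, u.2.2, v.2.1, v.2.2]
  have hulb : ∀ (u : I01) y, |(u:ℝ) - lbl y| ≤ 1 := fun u y => by
    rw [abs_le]; constructor <;> linarith [u.2.1, u.2.2, hp_lbl_nonneg y, hp_lbl_le y]
  have hb : ∀ j, (∫ p, Set.indicator (P.piece j) (fun _ => ((p.1 : ℝ) - lbl p.2)) (p.1 : ℝ) ∂Γ)
      = ∫ p, e j p.2.1 * ((p.2.1 : ℝ) - lbl p.2.2) ∂π := by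
    intro j
    have h1 : (fun p : I01 × Bool => Set.indicator (P.piece j) (fun _ => ((p.1 : ℝ) - lbl p.2)) (p.1 : ℝ))
      = fun p => e j p.1 * ((p.1 : ℝ) - lbl p.2) := by
      ext p; simp [Set.indicator, hidx, e]
    rw [h1, ← hmarg, integral_map]
    · exact Measurable.aemeasurable (by fun_prop)
    · refine Measurable.aestronglyMeasurable ?_
      exact ((hem j).comp measurable_fst).mul ((measurable_subtype_coe.comp measurable_fst).sub
        (hp_lbl_meas.comp measurable_snd))
  have hc : ∀ j, ∫ p, e j p.1 * ((p.1 : ℝ) - lbl p.2.2) ∂π = 0 := by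
    intro j
    have := hcal (e j) (hem j) ⟨1, heb j⟩
    unfold calErr at this
    rw [integral_map] at this
    · rw [← neg_eq_zero, ← integral_neg, ← this]
      congr 1; ext p; ring
    · exact Measurable.aemeasurable (by fun_prop)
    · refine Measurable.aestronglyMeasurable ?_
      exact ((hp_lbl_meas.comp measurable_snd).sub (measurable_subtype_coe.comp measurable_fst)).mul
        ((hem j).comp measurable_fst)
  have bm : ∀ a b : ℝ, |a| ≤ 1 → |b| ≤ 1 → |a * b| ≤ 1 := fun a b ha hb => by
    rw [abs_mul]; exact mul_le_one₀ ha (abs_nonneg _) hb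
  have i1 : ∀ j, Integrable (fun p : I01 × I01 × Bool => e j p.2.1 * ((p.2.1 : ℝ) - lbl p.2.2)) π :=
    fun j => hp_int π ((hev j).mul (hv.sub hl)) 1 fun p => bm _ _ (heb _ _) (hulb _ _)
  have i2 : ∀ j, Integrable (fun p : I01 × I01 × Bool => e j p.1 * ((p.1 : ℝ) - lbl p.2.2)) π :=
    fun j => hp_int π ((heu j).mul (hu.sub hl)) 1 fun p => bm _ _ (heb _ _) (hulb _ _)
  have i3 : Integrable (fun p : I01 × I01 × Bool => |(p.1 : ℝ) - (p.2.1 : ℝ)|) π :=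
    (hp_int π (hu.sub hv) 1 fun p => huvb _ _).abs
  have i4 : ∀ j, Integrable (fun p : I01 × I01 × Bool =>
      |e j p.2.1 * ((p.2.1 : ℝ) - lbl p.2.2) - e j p.1 * ((p.1 : ℝ) - lbl p.2.2)|) π :=
    fun j => ((i1 j).sub (i2 j)).abs
  have step : binnedECE Γ P ≤ ∑ j, ∫ p : I01 × I01 × Bool,
      |e j p.2.1 * ((p.2.1 : ℝ) - lbl p.2.2) - e j p.1 * ((p.1 : ℝ) - lbl p.2.2)| ∂π := by
    unfold binnedECE
    refine Finset.sum_le_sum fun j _ => ?_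
    rw [hb j, ← sub_zero (∫ p, e j p.2.1 * ((p.2.1 : ℝ) - lbl p.2.2) ∂π), ← hc j,
      ← integral_sub (i1 j) (i2 j)]
    exact abs_integral_le_integral_abs
  refine step.trans ?_
  rw [← integral_finsetSum _ fun j _ => i4 j, ← integral_const_mul,
    ← integral_add i3 (hDi.const_mul 2)]
  refine integral_mono (integrable_finsetSum _ fun j _ => i4 j) (i3.add (hDi.const_mul 2))
    fun p => ?_
  obtain ⟨u, v, y⟩ := p
  change ∑ j, |e j v * ((v : ℝ) - lbl y) - e j u * ((u : ℝ) - lbl y)| ≤ |(u:ℝ) - v| + 2 * D u v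
  rcases hD u v with ⟨i, hui, hvi⟩ | h1
  · have e1 : ∀ j, e j u = e j v := by
      intro j; simp [e, (hidx u i).1 hui, (hidx v i).1 hvi]
    have : ∀ j, |e j v * ((v : ℝ) - lbl y) - e j u * ((u : ℝ) - lbl y)| = e j v * |(u:ℝ) - v| := by
      intro j
      rw [e1 j, ← mul_sub, abs_mul, abs_of_nonneg (he0 j v), abs_sub_comm]
      congr 2; ring
    simp only [this]
    rw [← Finset.sum_mul, hesum, one_mul]
    linarith [hD0 u v]
  · have : ∀ j, |e j v * ((v : ℝ) - lbl y) - e j u * ((u : ℝ) - lbl y)| ≤ e j v + e j u := by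
      intro j
      refine (abs_sub _ _).trans ?_
      rw [abs_mul, abs_mul, abs_of_nonneg (he0 j v), abs_of_nonneg (he0 j u)]
      have h2 := mul_le_mul_of_nonneg_left (hulb v y) (he0 j v)
      have h3 := mul_le_mul_of_nonneg_left (hulb u y) (he0 j u)
      linarith
    refine (Finset.sum_le_sum fun j _ => this j).trans ?_
    rw [Finset.sum_add_distrib, hesum, hesum]
    linarith [abs_nonneg ((u:ℝ) - v)]

theorem hp_width (Γ : Measure (I01 × Bool)) [IsProbabilityMeasure Γ] (P : IntervalPartition)
    (ε : ℝ) (h : ∀ j, Metric.diam (P.piece j) ≤ ε) : avgWidth Γ P ≤ ε := by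
  classical
  obtain ⟨idx, hm, hidx⟩ := hp_exists_idx P
  have hq : ∀ j, (∫ p, Set.indicator (P.piece j) (fun _ => (1 : ℝ)) (p.1 : ℝ) ∂Γ) =
      ∫ p, (if idx p.1 = j then (1:ℝ) else 0) ∂Γ := by
    intro j; congr 1; ext p; simp [Set.indicator, hidx]
  have hi : ∀ j, Integrable (fun p : I01 × Bool => if idx p.1 = j then (1:ℝ) else 0) Γ := by
    intro j
    refine hp_int Γ ((Measurable.of_discrete (f := fun i : Fin P.m => if i = j then (1:ℝ) else 0)).comp
      (hm.comp measurable_fst)) 1 fun p => ?_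
    split <;> simp
  unfold avgWidth
  simp only [hq]
  calc _ ≤ ∑ j, (∫ p, (if idx p.1 = j then (1:ℝ) else 0) ∂Γ) * ε := by
        refine Finset.sum_le_sum fun j _ => mul_le_mul_of_nonneg_left (h j) ?_
        exact integral_nonneg fun p => by dsimp only; split <;> norm_num
    _ = ε := by
        rw [← Finset.sum_mul, ← integral_finsetSum _ fun j _ => hi j]
        simp

/-- shifted grid partition -/
def hpPart (ε r : ℝ) (hε : 0 < ε) : IntervalPartition where
  m := ⌊1 / ε + r⌋₊ + 1
  piece j := {x | x ∈ Set.Icc (0:ℝ) 1 ∧ ⌊x / ε + r⌋₊ = j}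
  ordConn j := by
    refine ⟨?_⟩
    rintro x ⟨hx, hxj⟩ y ⟨hy, hyj⟩ z ⟨h1, h2⟩
    refine ⟨⟨hx.1.trans h1, h2.trans hy.2⟩, le_antisymm ?_ ?_⟩
    · rw [← hyj]; gcongr
    · rw [← hxj]; gcongr
  disj i j hij := by
    rw [Set.disjoint_left]
    rintro x ⟨_, h1⟩ ⟨_, h2⟩
    exact hij (Fin.ext (h1.symm.trans h2))
  cover := by
    ext x
    simp only [Set.mem_iUnion, Set.mem_ofPred_eq]
    constructor
    · rintro ⟨_, h, _⟩; exact h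
    · intro h
      refine ⟨⟨⌊x / ε + r⌋₊, Nat.lt_succ_of_le ?_⟩, h, rfl⟩
      have := h.2
      gcongr

theorem hpPart_diam (ε r : ℝ) (hε : 0 < ε) (hr : 0 ≤ r) (j) :
    Metric.diam ((hpPart ε r hε).piece j) ≤ ε := by
  refine Metric.diam_le_of_forall_dist_le hε.le ?_
  rintro x ⟨hx, hxj⟩ y ⟨hy, hyj⟩
  have hx0 : 0 ≤ x / ε + r := add_nonneg (div_nonneg hx.1 hε.le) hr
  have hy0 : 0 ≤ y / ε + r := add_nonneg (div_nonneg hy.1 hε.le) hr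
  have a1 := Nat.floor_le hx0
  have a2 := Nat.lt_floor_add_one (x / ε + r)
  have b1 := Nat.floor_le hy0
  have b2 := Nat.lt_floor_add_one (y / ε + r)
  rw [hxj] at a1 a2
  rw [hyj] at b1 b2
  have ex : x = x / ε * ε := by field_simp
  have ey : y = y / ε * ε := by field_simp
  rw [Real.dist_eq, abs_le]
  constructor <;> nlinarith

theorem hp_floor_int (a : ℝ) : ∫ r in (0:ℝ)..1, ((⌊a + r⌋ : ℤ) : ℝ) = a := by
  have hper : Function.Periodic (fun x : ℝ => Int.fract x) 1 := fun x => by simp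
  have h1 : ∫ r in (0:ℝ)..1, Int.fract (a + r) = 1 / 2 := by
    rw [intervalIntegral.integral_comp_add_left (fun x => Int.fract x) a, add_zero,
      hper.intervalIntegral_add_eq a 0, zero_add]
    have : ∫ x in (0:ℝ)..1, Int.fract x = ∫ x in (0:ℝ)..1, x := by
      rw [intervalIntegral.integral_of_le zero_le_one, intervalIntegral.integral_of_le zero_le_one,
        ← integral_Ico_eq_integral_Ioc, ← integral_Ico_eq_integral_Ioc]
      refine setIntegral_congr_fun measurableSet_Ico fun x hx => ?_
      exact Int.fract_eq_self.2 hx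
    rw [this, integral_id]; norm_num
  have h2 : ∀ r : ℝ, ((⌊a + r⌋ : ℤ) : ℝ) = (a + r) - Int.fract (a + r) := fun r => by
    rw [Int.self_sub_fract]
  simp only [h2]
  rw [intervalIntegral.integral_sub, h1, intervalIntegral.integral_add, integral_id]
  · simp
  · simp
  · simp
  · exact (by fun_prop : Continuous fun r : ℝ => a + r).intervalIntegrable _ _
  · rw [intervalIntegrable_iff, Set.uIoc_of_le zero_le_one]
    refine hp_int _ (by fun_prop) 1 fun x => ?_
    rw [Int.abs_fract]
    exact (Int.fract_lt_one _).le

theorem hp_floor_ii (a : ℝ) :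
    IntervalIntegrable (fun r => ((⌊a + r⌋ : ℤ) : ℝ)) volume 0 1 := by
  apply MonotoneOn.intervalIntegrable
  intro x _ y _ h
  dsimp only
  gcongr

theorem hp_floor_abs (a b : ℝ) :
    ∫ r in (0:ℝ)..1, |((⌊a + r⌋ : ℤ) : ℝ) - ((⌊b + r⌋ : ℤ) : ℝ)| = |a - b| := by
  wlog h : b ≤ a generalizing a b
  · rw [abs_sub_comm a b, ← this b a (le_of_not_ge h)]
    congr 1; ext r; rw [abs_sub_comm]
  have : ∀ r : ℝ, |((⌊a + r⌋ : ℤ) : ℝ) - ((⌊b + r⌋ : ℤ) : ℝ)| =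
      ((⌊a + r⌋ : ℤ) : ℝ) - ((⌊b + r⌋ : ℤ) : ℝ) := fun r => by
    rw [abs_of_nonneg]
    rw [sub_nonneg]
    gcongr
  simp only [this]
  rw [intervalIntegral.integral_sub (hp_floor_ii a) (hp_floor_ii b), hp_floor_int, hp_floor_int,
    abs_of_nonneg (sub_nonneg.2 h)]

/-- separation -/
def hpD (ε r : ℝ) (u v : I01) : ℝ := |((⌊(u:ℝ) / ε + r⌋ : ℤ) : ℝ) - ((⌊(v:ℝ) / ε + r⌋ : ℤ) : ℝ)|

theorem hpD_bound (ε r : ℝ) (hε : 0 < ε) (u v : I01) : |hpD ε r u v| ≤ 1 / ε + 1 := by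
  unfold hpD
  rw [abs_abs]
  have a1 := Int.floor_le ((u:ℝ) / ε + r)
  have a2 := Int.lt_floor_add_one ((u:ℝ) / ε + r)
  have b1 := Int.floor_le ((v:ℝ) / ε + r)
  have b2 := Int.lt_floor_add_one ((v:ℝ) / ε + r)
  have c1 : (u:ℝ) / ε ≤ 1 / ε := by gcongr; exact u.2.2
  have c2 : (v:ℝ) / ε ≤ 1 / ε := by gcongr; exact v.2.2
  have c3 : 0 ≤ (u:ℝ) / ε := div_nonneg u.2.1 hε.le
  have c4 : 0 ≤ (v:ℝ) / ε := div_nonneg v.2.1 hε.le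
  rw [abs_le]
  constructor <;> linarith

theorem hpD_meas (ε : ℝ) : Measurable fun z : ℝ × (I01 × I01 × Bool) => hpD ε z.1 z.2.1 z.2.2.1 := by
  unfold hpD
  have e1 : Measurable fun z : ℝ × (I01 × I01 × Bool) => ((z.2.1 : I01) : ℝ) / ε + z.1 := by fun_prop
  have e2 : Measurable fun z : ℝ × (I01 × I01 × Bool) => ((z.2.2.1 : I01) : ℝ) / ε + z.1 := by fun_prop
  have hc : Measurable fun n : ℤ => (n : ℝ) := Measurable.of_discrete
  exact ((hc.comp e1.floor).sub (hc.comp e2.floor)).abs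

theorem hpD_nonneg (ε r : ℝ) (u v : I01) : 0 ≤ hpD ε r u v := abs_nonneg _

theorem hpD_integral (ε : ℝ) (hε : 0 < ε) (u v : I01) :
    ∫ r, hpD ε r u v ∂(volume.restrict (Set.Ioc (0:ℝ) 1)) = |(u:ℝ) - v| / ε := by
  have := hp_floor_abs ((u:ℝ) / ε) ((v:ℝ) / ε)
  rw [intervalIntegral.integral_of_le zero_le_one] at this
  refine this.trans ?_
  rw [← sub_div, abs_div, abs_of_pos hε]

theorem hpD_one_le (ε r : ℝ) (u v : I01) (h : ⌊(u:ℝ) / ε + r⌋ ≠ ⌊(v:ℝ) / ε + r⌋) :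
    1 ≤ hpD ε r u v := by
  unfold hpD
  rw [← Int.cast_sub, ← Int.cast_abs]
  exact_mod_cast Int.one_le_abs (sub_ne_zero.2 h)

attribute [irreducible] hpD

theorem hpD_int (π : Measure (I01 × I01 × Bool)) [IsProbabilityMeasure π] (ε r : ℝ) (hε : 0 < ε) :
    Integrable (fun p : I01 × I01 × Bool => hpD ε r p.1 p.2.1) π := by
  have hm : Measurable fun p : I01 × I01 × Bool => hpD ε r p.1 p.2.1 :=
    (hpD_meas ε).comp (g := fun z : ℝ × (I01 × I01 × Bool) => hpD ε z.1 z.2.1 z.2.2.1)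
      (f := fun p : I01 × I01 × Bool => (r, p)) (measurable_const.prodMk measurable_id)
  exact hp_int π hm (1 / ε + 1) fun z => hpD_bound ε r hε z.1 z.2.1

theorem hp_exists_r (π : Measure (I01 × I01 × Bool)) [IsProbabilityMeasure π] (ε : ℝ) (hε : 0 < ε) :
    ∃ r : ℝ, 0 ≤ r ∧ ∫ p, hpD ε r p.1 p.2.1 ∂π ≤ (∫ p, |(p.1 : ℝ) - (p.2.1 : ℝ)| ∂π) / ε := by
  let ν : Measure ℝ := volume.restrict (Set.Ioc (0:ℝ) 1)
  have : IsProbabilityMeasure ν := ⟨by simp [ν]⟩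
  have hint : Integrable (fun z : ℝ × (I01 × I01 × Bool) => hpD ε z.1 z.2.1 z.2.2.1) (ν.prod π) :=
    hp_int _ (hpD_meas ε) (1 / ε + 1) fun z => hpD_bound ε z.1 hε z.2.1 z.2.2.1
  have hsw : ∫ r, ∫ p, hpD ε r p.1 p.2.1 ∂π ∂ν = (∫ p, |(p.1 : ℝ) - (p.2.1 : ℝ)| ∂π) / ε := by
    rw [integral_integral_swap (f := fun (r : ℝ) (p : I01 × I01 × Bool) => hpD ε r p.1 p.2.1) hint, ← integral_div]
    congr 1; ext p
    exact hpD_integral ε hε p.1 p.2.1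
  have hout : Integrable (fun r => ∫ p, hpD ε r p.1 p.2.1 ∂π) ν := hint.integral_prod_left
  have hnull : ν (Set.Ioc (0:ℝ) 1)ᶜ = 0 := by simp [ν]
  obtain ⟨r, hr, hle⟩ := exists_notMem_null_le_integral hout hnull
  simp only [Set.mem_compl_iff, not_not] at hr
  exact ⟨r, hr.1.le, hle.trans_eq hsw⟩

theorem hp_intCE_le (Γ : Measure (I01 × Bool)) [IsProbabilityMeasure Γ]
    (π : Measure (I01 × I01 × Bool)) (hπ : π ∈ extSet Γ) (ε : ℝ) (hε : 0 < ε) :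
    intCE Γ ≤ ∫ p, |(p.1 : ℝ) - (p.2.1 : ℝ)| ∂π + 2 * ((∫ p, |(p.1 : ℝ) - (p.2.1 : ℝ)| ∂π) / ε)
      + ε := by
  have hprob := hπ.1
  obtain ⟨r, hr, hle⟩ := hp_exists_r π ε hε
  have hbd : BddBelow {x | ∃ P : IntervalPartition, x = binnedECE Γ P + avgWidth Γ P} := by
    refine ⟨0, ?_⟩
    rintro x ⟨P, rfl⟩
    exact hp_nonneg Γ P
  refine (csInf_le hbd ⟨hpPart ε r hε, rfl⟩).trans ?_
  have hw := hp_width Γ (hpPart ε r hε) ε (hpPart_diam ε r hε hr)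
  have hb := hp_binned Γ π hπ (hpPart ε r hε) (hpD ε r)
    (hpD_int π ε r hε) (hpD_nonneg ε r) (by
      intro u v
      have hu0 : 0 ≤ (u:ℝ) / ε + r := add_nonneg (div_nonneg u.2.1 hε.le) hr
      by_cases h : ⌊(u:ℝ) / ε + r⌋ = ⌊(v:ℝ) / ε + r⌋
      · left
        have hmem : (u:ℝ) ∈ ⋃ j, (hpPart ε r hε).piece j := by
          rw [(hpPart ε r hε).cover]; exact u.2
        obtain ⟨j, hj⟩ := Set.mem_iUnion.1 hmem
        refine ⟨j, hj, v.2, ?_⟩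
        rw [← hj.2, ← Int.floor_toNat, ← Int.floor_toNat, h]
      · right
        exact hpD_one_le ε r u v h)
  linarith

theorem hp_intCE_nonneg (Γ : Measure (I01 × Bool)) : 0 ≤ intCE Γ := by
  apply Real.sInf_nonneg
  rintro x ⟨P, rfl⟩
  exact hp_nonneg Γ P

theorem hp_intCE_sqrt (Γ : Measure (I01 × Bool)) [IsProbabilityMeasure Γ]
    (π : Measure (I01 × I01 × Bool)) (hπ : π ∈ extSet Γ) :
    intCE Γ ≤ 4 * Real.sqrt (∫ p, |(p.1 : ℝ) - (p.2.1 : ℝ)| ∂π) := by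
  have hprob := hπ.1
  have key := hp_intCE_le Γ π hπ
  have hb : ∀ p : I01 × I01 × Bool, |(p.1 : ℝ) - (p.2.1 : ℝ)| ≤ 1 := fun p => by
    rw [abs_le]; constructor <;> linarith [p.1.2.1, p.1.2.2, p.2.1.2.1, p.2.1.2.2]
  have hm : Measurable fun p : I01 × I01 × Bool => |(p.1 : ℝ) - (p.2.1 : ℝ)| := by fun_prop
  have h1 : ∫ p, |(p.1 : ℝ) - (p.2.1 : ℝ)| ∂π ≤ 1 := by
    have := integral_mono (hp_int π hm 1 fun p => by rw [abs_abs]; exact hb p)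
      (integrable_const (1:ℝ)) hb
    simpa using this
  have h0 : 0 ≤ ∫ p, |(p.1 : ℝ) - (p.2.1 : ℝ)| ∂π := integral_nonneg fun p => abs_nonneg _
  generalize (∫ p, |(p.1 : ℝ) - (p.2.1 : ℝ)| ∂π) = δ at key h0 h1 ⊢
  rcases h0.eq_or_lt with h | h
  · rw [← h] at key ⊢
    simp only [Real.sqrt_zero, mul_zero]
    refine le_of_forall_pos_le_add fun ε hε => ?_
    simpa using key ε hε
  · have hs : 0 < Real.sqrt δ := Real.sqrt_pos.2 h
    have hs1 : Real.sqrt δ ≤ 1 := Real.sqrt_le_one.2 h1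
    have hsq := Real.mul_self_sqrt h0
    have k := key _ hs
    rw [Real.div_sqrt] at k
    nlinarith

theorem hp_ext_nonempty (Γ : Measure (I01 × Bool)) [IsProbabilityMeasure Γ] :
    (extSet Γ).Nonempty := by
  have hlm : Measurable fun p : I01 × Bool => lbl p.2 := hp_lbl_meas.comp measurable_snd
  have hi : Integrable (fun p : I01 × Bool => lbl p.2) Γ := hp_int Γ hlm 1 fun p =>
    abs_le.2 ⟨by linarith [hp_lbl_nonneg p.2], hp_lbl_le p.2⟩
  let c : I01 := ⟨∫ p, lbl p.2 ∂Γ, integral_nonneg fun p => hp_lbl_nonneg _, by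
    have := integral_mono hi (integrable_const (1:ℝ)) fun p => hp_lbl_le p.2
    simpa using this⟩
  have hf : Measurable fun p : I01 × Bool => (c, p.1, p.2) := by fun_prop
  refine ⟨Γ.map fun p => (c, p.1, p.2), Measure.isProbabilityMeasure_map hf.aemeasurable, ?_, ?_⟩
  · rw [Measure.map_map (by fun_prop) hf]
    exact Measure.map_id
  · rw [Measure.map_map (by fun_prop) hf]
    intro w hw _
    unfold calErr
    rw [integral_map (Measurable.aemeasurable (by fun_prop))]
    · simp only [Function.comp]
      rw [integral_mul_const, integral_sub hi (integrable_const _)]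
      simp [c]
    · exact ((hlm.sub (measurable_subtype_coe.comp measurable_fst)).mul
        (hw.comp measurable_fst)).aestronglyMeasurable

theorem hp_part_nonempty : Nonempty IntervalPartition := ⟨hpPart 1 0 one_pos⟩

/-- For every probability distribution `Γ` over `[0,1]×{0,1}`,
`udCE(Γ) ≤ intCE(Γ) ≤ 4·√(ldCE(Γ))`. -/
theorem intCE_bounds (Γ : Measure (I01 × Bool)) [IsProbabilityMeasure Γ] :
    udCE Γ ≤ intCE Γ ∧ intCE Γ ≤ 4 * Real.sqrt (ldCE Γ) := by
  constructor
  · obtain ⟨P⟩ := hp_part_nonempty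
    refine le_csInf ⟨_, P, rfl⟩ ?_
    rintro x ⟨P, rfl⟩
    exact hp_ud Γ P
  · obtain ⟨π, hπ⟩ := hp_ext_nonempty Γ
    have h0 := hp_intCE_nonneg Γ
    have : (intCE Γ / 4) ^ 2 ≤ ldCE Γ := by
      refine le_csInf ⟨_, π, hπ, rfl⟩ ?_
      rintro x ⟨π', hπ', rfl⟩
      have h := hp_intCE_sqrt Γ π' hπ'
      have hn : 0 ≤ ∫ p, |(p.1 : ℝ) - (p.2.1 : ℝ)| ∂π' := integral_nonneg fun p => abs_nonneg _
      exact (Real.le_sqrt (by positivity) hn).1 (by linarith)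
    have := Real.le_sqrt_of_sq_le this
    linarith
end
end

section
/- Let c, s > 0 and a, b > 0, and let μ be a function mapping each probability distribution Γ over [0,1]×{0,1} to a real number. Suppose that for every finite set 𝒳, every probability distribution D over 𝒳×{0,1}, and every predictor f:𝒳→[0,1], it holds that b·(dCE_D(f))^s ≤ μ(D_f) ≤ a·(dCE_D(f))^c. Then s ≥ 2c. -/
open MeasureTheory Set

noncomputable section

def wtM {Ω ι : Type*} [MeasurableSpace Ω] [Fintype ι] (w : ι → ℝ) (x : ι → Ω) : Measure Ω :=
  ∑ i, ENNReal.ofReal (w i) • Measure.dirac (x i)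

lemma wtM_map {Ω Ω' ι : Type*} [MeasurableSpace Ω] [MeasurableSpace Ω'] [Fintype ι]
    (w : ι → ℝ) (x : ι → Ω) (f : Ω → Ω') (hf : Measurable f) :
    (wtM w x).map f = wtM w (fun i => f (x i)) := by
  ext s hs
  rw [Measure.map_apply hf hs]
  simp [wtM, Measure.finset_sum_apply, Measure.dirac_apply' _ hs,
    Measure.dirac_apply' _ (hf hs)]
  rfl

lemma wtM_integral {Ω ι : Type*} [MeasurableSpace Ω] [MeasurableSingletonClass Ω] [Fintype ι]
    (w : ι → ℝ) (hw : ∀ i, 0 ≤ w i) (x : ι → Ω) (f : Ω → ℝ) :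
    ∫ p, f p ∂(wtM w x) = ∑ i, w i * f (x i) := by
  unfold wtM
  rw [integral_finset_sum_measure]
  · refine Finset.sum_congr rfl fun i _ => ?_
    rw [integral_smul_measure, integral_dirac, ENNReal.toReal_ofReal (hw i), smul_eq_mul]
  · intro i _
    exact (integrable_dirac (by simp)).smul_measure ENNReal.ofReal_ne_top

lemma wtM_prob {Ω ι : Type*} [MeasurableSpace Ω] [Fintype ι]
    (w : ι → ℝ) (hw : ∀ i, 0 ≤ w i) (h1 : ∑ i, w i = 1) (x : ι → Ω) :
    IsProbabilityMeasure (wtM w x) := by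
  constructor
  simp [wtM, Measure.finset_sum_apply]
  rw [← ENNReal.ofReal_sum_of_nonneg (fun i _ => hw i), h1, ENNReal.ofReal_one]

/-- weights -/
def wt (α : ℝ) : Fin 6 → ℝ := ![(1/2-α)/2, 1/4, α/2, 1/4, (1/2-α)/2, α/2]

def pt2 : Fin 6 → (Bool × Bool) × Bool :=
  ![((false,false),true), ((false,false),false), ((false,true),true),
    ((true,false),true), ((true,false),false), ((true,true),false)]

def pt1 (i : Fin 6) : Bool × Bool := ((pt2 i).1.1, (pt2 i).2)

lemma wt_nonneg (α : ℝ) (h0 : 0 < α) (h1 : α < 1/2) (i : Fin 6) : 0 ≤ wt α i := by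
  fin_cases i <;> simp [wt] <;> linarith

lemma wt_sum (α : ℝ) : ∑ i, wt α i = 1 := by
  simp [wt, Fin.sum_univ_six]; ring

def lev (α : ℝ) (h0 : 0 < α) (h1 : α < 1/2) (v : Bool) : I01 :=
  if v then ⟨1/2+α, by constructor <;> linarith⟩ else ⟨1/2-α, by constructor <;> linarith⟩

lemma dCE_nonneg' {𝒳 : Type*} [MeasurableSpace 𝒳] (D : Measure (𝒳 × Bool)) (f : 𝒳 → I01) :
    0 ≤ dCE D f := by
  apply Real.sInf_nonneg
  rintro x ⟨g, _, rfl⟩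
  exact integral_nonneg fun _ => abs_nonneg _

lemma calErr_pred {𝒳 : Type*} [MeasurableSpace 𝒳] (w' : Fin 6 → ℝ) (hw : ∀ i, 0 ≤ w' i)
    (x : Fin 6 → 𝒳 × Bool) (g : 𝒳 → I01) (hg : Measurable g) (w : I01 → ℝ) :
    calErr (predDist (wtM w' x) g) w =
      ∑ i, w' i * ((lbl (x i).2 - (g (x i).1 : ℝ)) * w (g (x i).1)) := by
  unfold calErr predDist
  rw [wtM_map _ _ _ (by fun_prop), wtM_integral _ hw]

lemma dCE1 (α : ℝ) (h0 : 0 < α) (h1 : α < 1/2) :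
    α ≤ dCE (wtM (wt α) pt1) (lev α h0 h1) := by
  apply le_csInf
  · refine ⟨_, (fun _ => ⟨1/2, by constructor <;> linarith⟩), ⟨by fun_prop, ?_⟩, rfl⟩
    intro w _ _
    rw [calErr_pred _ (wt_nonneg α h0 h1) _ _ (by fun_prop)]
    simp [wt, Fin.sum_univ_six, pt1, pt2, lbl]; ring
  · rintro x ⟨g, ⟨hg, hcal⟩, rfl⟩
    have := hcal (fun t => 1/2 - (t:ℝ)) (by fun_prop) ⟨1, fun t => by
      have := t.2.1; have := t.2.2
      rw [abs_le]; constructor <;> linarith⟩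
    rw [calErr_pred _ (wt_nonneg α h0 h1) _ _ hg] at this
    rw [wtM_integral _ (wt_nonneg α h0 h1)]
    simp [wt, Fin.sum_univ_six, pt1, pt2, lbl] at this
    have e : (1/2 - (g true : ℝ))^2 + (1/2 - (g false : ℝ))^2 = 0 := by nlinarith
    have e1 : (g true : ℝ) = 1/2 := by nlinarith [sq_nonneg (1/2 - (g true : ℝ)), sq_nonneg (1/2 - (g false : ℝ))]
    have e2 : (g false : ℝ) = 1/2 := by nlinarith [sq_nonneg (1/2 - (g true : ℝ)), sq_nonneg (1/2 - (g false : ℝ))]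
    simp [wt, Fin.sum_univ_six, pt1, pt2, lev, e1, e2, abs_of_pos h0]
    linarith

lemma dCE2 (α : ℝ) (h0 : 0 < α) (h1 : α < 1/2) :
    dCE (wtM (wt α) pt2) (fun p => lev α h0 h1 p.1) ≤ 2 * α ^ 2 := by
  apply csInf_le
  · refine ⟨0, ?_⟩
    rintro x ⟨g, _, rfl⟩
    exact integral_nonneg fun _ => abs_nonneg _
  · refine ⟨fun p => lev α h0 h1 (xor p.1 p.2), ⟨measurable_of_finite _, ?_⟩, ?_⟩
    · intro w _ _
      rw [calErr_pred _ (wt_nonneg α h0 h1) _ _ (measurable_of_finite _)]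
      simp [wt, Fin.sum_univ_six, pt2, lbl, lev]; ring
    · rw [wtM_integral _ (wt_nonneg α h0 h1)]
      simp [wt, Fin.sum_univ_six, pt2, lev]
      have a1 : |2⁻¹ - α - (2⁻¹ + α)| = 2 * α := by
        rw [abs_of_nonpos] <;> linarith
      have a2 : |α + α| = 2 * α := by
        rw [abs_of_nonneg] <;> linarith
      rw [a1, a2]; ring

lemma pred_eq (α : ℝ) (h0 : 0 < α) (h1 : α < 1/2) :
    predDist (wtM (wt α) pt1) (lev α h0 h1) =
      predDist (wtM (wt α) pt2) (fun p => lev α h0 h1 p.1) := by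
  unfold predDist
  rw [wtM_map _ _ _ (measurable_of_finite _), wtM_map _ _ _ (measurable_of_finite _)]
  rfl

/-- Any `(c,s)`-consistent calibration measure `μ` computable in the
prediction-only access model must satisfy `s ≥ 2c`. -/
theorem consistent_PA_measure_quadratic_gap (c s a b : ℝ)
    (hc : 0 < c) (hs : 0 < s) (ha : 0 < a) (hb : 0 < b)
    (μ : Measure (I01 × Bool) → ℝ)
    (h : ∀ (𝒳 : Type) [Fintype 𝒳] [MeasurableSpace 𝒳] [DiscreteMeasurableSpace 𝒳]
        (D : Measure (𝒳 × Bool)), IsProbabilityMeasure D → ∀ f : 𝒳 → I01,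
        b * dCE D f ^ s ≤ μ (predDist D f) ∧ μ (predDist D f) ≤ a * dCE D f ^ c) :
    s ≥ 2 * c := by
  by_contra hlt
  push Not at hlt
  have key : ∀ α : ℝ, 0 < α → α < 1/2 → b ≤ a * 2 ^ c * α ^ (2 * c - s) := by
    intro α h0 h1
    have p1 := (h Bool (wtM (wt α) pt1) (wtM_prob _ (wt_nonneg α h0 h1) (wt_sum α) _)
      (lev α h0 h1)).1
    have p2 := (h (Bool × Bool) (wtM (wt α) pt2) (wtM_prob _ (wt_nonneg α h0 h1) (wt_sum α) _)
      (fun p => lev α h0 h1 p.1)).2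
    rw [← pred_eq] at p2
    have q1 := Real.rpow_le_rpow h0.le (dCE1 α h0 h1) hs.le
    have q2 := Real.rpow_le_rpow (dCE_nonneg' _ _) (dCE2 α h0 h1) hc.le
    have q3 : b * α ^ s ≤ a * (2 * α ^ 2) ^ c :=
      (mul_le_mul_of_nonneg_left q1 hb.le).trans
        (p1.trans (p2.trans (mul_le_mul_of_nonneg_left q2 ha.le)))
    have e : (2 * α ^ 2) ^ c = 2 ^ c * α ^ (2 * c - s) * α ^ s := by
      rw [Real.mul_rpow (by norm_num) (by positivity), mul_assoc, ← Real.rpow_add h0,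
        ← Real.rpow_natCast α 2, ← Real.rpow_mul h0.le]
      congr 2
      push_cast; ring
    rw [e] at q3
    have hp : 0 < α ^ s := Real.rpow_pos_of_pos h0 s
    refine le_of_mul_le_mul_right ?_ hp
    linarith
  have hpos : 0 < 2 * c - s := by linarith
  have hcont : Filter.Tendsto (fun α : ℝ => a * 2 ^ c * α ^ (2 * c - s))
      (nhdsWithin 0 (Set.Ioi 0)) (nhds 0) := by
    have := ((Real.continuousAt_rpow_const 0 (2 * c - s) (Or.inr hpos.le)).tendsto.const_mul
      (a * 2 ^ c)).mono_left (nhdsWithin_le_nhds (s := Set.Ioi (0:ℝ)))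
    simpa [Real.zero_rpow hpos.ne'] using this
  have : b ≤ 0 := by
    refine ge_of_tendsto hcont ?_
    filter_upwards [Ioo_mem_nhdsGT (show (0:ℝ) < 1/2 by norm_num)] with α hα
    exact key α hα.1 hα.2
  linarith
end
end
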